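/- arXiv:2211.02758 — 2 statements merged into one kernel-verified Lean document; each statement's English description precedes it below -/
import Mathlib

section
/- Uniform operator bound for the BBGKY operators: Let ε ∈ (0,1) and suppose M/N ≤ ε. Then for every s ∈ ℕ, every 0 ≤ k ≤ M−1 and every g ∈ L^1_sym(ℝ^{d(s+k)}), ‖C^N_{s,s+k} g‖_{L^1} ≤ R_k · s · ‖g‖_{L^1}, where R_k := 2 Σ_{ℓ=k+1}^M β_ℓ (1−ε)^{−ℓ} binom(ℓ,k); in particular the constants R_k do not depend on s or N. -/
open MeasureTheory Filter Finset
open scoped Classical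

noncomputable section

/-- The single-particle velocity space `ℝ^d`. -/
abbrev ESp (d : ℕ) := EuclideanSpace ℝ (Fin d)

/-- Action of a permutation of `{1,…,K}` on `ℝ^{dK}`, permuting the `K` blocks of `ℝ^d`:
`σ(V)_i = V_{σ(i)}`. -/
def permAct {d K : ℕ} (σ : Equiv.Perm (Fin K)) (V : Fin K → ESp d) : Fin K → ESp d :=
  fun i => V (σ i)

/-- `f` is invariant under permutations of its `n` blocks of `d` variables. -/
def SymFun {d n : ℕ} (f : (Fin n → ESp d) → ℝ) : Prop :=
  ∀ σ : Equiv.Perm (Fin n), ∀ V : Fin n → ESp d, f (fun j => V (σ j)) = f V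

/-- Extension `T^ω_{i_1⋯i_K}` of a `K`-particle map to `N` particles: the particles labelled by
`ι` collide according to `Tω`, the others are untouched. -/
def extendMap {d K N : ℕ} (Tω : (Fin K → ESp d) → Fin K → ESp d)
    (ι : Fin K → Fin N) (V : Fin N → ESp d) : Fin N → ESp d :=
  fun j => if h : ∃ a, ι a = j then Tω (fun a => V (ι a)) h.choose else V j

/-- **(H1)**: each `T_K^ω` conserves kinetic energy (is an isometry of `ℝ^{dK}`). -/
def KacH1 (d M : ℕ) (S : ℕ → Type*)
    (T : ∀ K, S K → (Fin K → ESp d) ≃ₗ[ℝ] (Fin K → ESp d)) : Prop :=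
  ∀ K, 1 ≤ K → K ≤ M → ∀ ω : S K, ∀ V : Fin K → ESp d,
    ∑ i : Fin K, ‖T K ω V i‖ ^ 2 = ∑ i : Fin K, ‖V i‖ ^ 2

/-- **(H2)**: on average over the collision kernel, `T_K` is an involution. -/
def KacH2 (d M : ℕ) (S : ℕ → Type*) [∀ K, MeasurableSpace (S K)]
    (b : ∀ K, Measure (S K))
    (T : ∀ K, S K → (Fin K → ESp d) ≃ₗ[ℝ] (Fin K → ESp d)) : Prop :=
  ∀ K, 1 ≤ K → K ≤ M → ∀ φ : (Fin K → ESp d) → ℝ, Continuous φ →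
    ∀ V : Fin K → ESp d,
      ∫ ω, φ ((T K ω).symm V) ∂(b K) = ∫ ω, φ (T K ω V) ∂(b K)

/-- **(H3)**: on average over the collision kernel, `T_K` is invariant under relabelling of the
particles: `∫ φ((σ∘T_K^ω∘σ⁻¹)V) db_K = ∫ φ(T_K^ω V) db_K`. -/
def KacH3 (d M : ℕ) (S : ℕ → Type*) [∀ K, MeasurableSpace (S K)]
    (b : ∀ K, Measure (S K))
    (T : ∀ K, S K → (Fin K → ESp d) ≃ₗ[ℝ] (Fin K → ESp d)) : Prop :=
  ∀ K, 1 ≤ K → K ≤ M → ∀ σ : Equiv.Perm (Fin K), ∀ φ : (Fin K → ESp d) → ℝ, Continuous φ →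
    ∀ V : Fin K → ESp d,
      ∫ ω, φ (permAct σ (T K ω (permAct σ⁻¹ V))) ∂(b K) = ∫ ω, φ (T K ω V) ∂(b K)

/-- Joint measurability of the transformation laws. -/
def KacMeas (d : ℕ) (S : ℕ → Type*) [∀ K, MeasurableSpace (S K)]
    (T : ∀ K, S K → (Fin K → ESp d) ≃ₗ[ℝ] (Fin K → ESp d)) : Prop :=
  ∀ K, Measurable (fun p : S K × (Fin K → ESp d) => T K p.1 p.2)

/-- The operator `Ω_{i_1⋯i_K} f = ∫_{S_K} (f∘T^ω_{i_1⋯i_K} − f) db_K(ω)`. -/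
def OmegaIdx {d : ℕ} {S : ℕ → Type*} [∀ K, MeasurableSpace (S K)]
    (b : ∀ K, Measure (S K))
    (T : ∀ K, S K → (Fin K → ESp d) ≃ₗ[ℝ] (Fin K → ESp d))
    (K N : ℕ) (ι : Fin K → Fin N) (f : (Fin N → ESp d) → ℝ) : (Fin N → ESp d) → ℝ :=
  fun V => ∫ ω, (f (extendMap (⇑(T K ω)) ι V) - f V) ∂(b K)

/-- The index map selecting the slots `i_1,…,i_n, s+1,…,s+r` among `s + r` particles. -/
def collIdx (s n r K : ℕ) (hK : K = n + r) (i : Fin n → Fin s) : Fin K → Fin (s + r) :=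
  fun a =>
    if h : (a : ℕ) < n then Fin.castLE (Nat.le_add_right s r) (i ⟨a, h⟩)
    else ⟨s + ((a : ℕ) - n), by have := a.isLt; omega⟩

/-- The collision operator `C^{s,K,n}_{i_1⋯i_n} : L¹_sym(ℝ^{d(s+r)}) → L¹_sym(ℝ^{ds})`,
`r = K − n`, from Definition 6.1 of the paper. -/
def collOp {d : ℕ} {S : ℕ → Type*} [∀ K, MeasurableSpace (S K)]
    (b : ∀ K, Measure (S K))
    (T : ∀ K, S K → (Fin K → ESp d) ≃ₗ[ℝ] (Fin K → ESp d))
    (s n r K : ℕ) (hK : K = n + r) (i : Fin n → Fin s)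
    (g : (Fin (s + r) → ESp d) → ℝ) : (Fin s → ESp d) → ℝ :=
  fun V => ∫ p : S K × (Fin r → ESp d),
    (g (extendMap (⇑(T K p.1)) (collIdx s n r K hK i) (Fin.append V p.2)) -
      g (Fin.append V p.2)) ∂((b K).prod volume)

/-- The marginal (partial trace) `Tr_{j+1,…,N} f` of an `N`-particle density; it is the zero
function for `j > N`. -/
def margOf {d : ℕ} (N j : ℕ) (f : (Fin N → ESp d) → ℝ) : (Fin j → ESp d) → ℝ :=
  if h : j ≤ N then
    fun V => ∫ w : Fin (N - j) → ESp d, f (fun a => Fin.append V w (Fin.cast (by omega) a))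
  else 0

/-- The BBGKY-hierarchy operator
`C^N_{s,s+k} = Σ_{n=1}^{M−k} β_{k+n} (N/binom(N,k+n)) binom(N−s,k)
  Σ_{i_1<⋯<i_n≤s} C^{s,k+n,n}_{i_1⋯i_n}` (zero when `s + k > N`). -/
def bbgkyC {d : ℕ} {S : ℕ → Type*} [∀ K, MeasurableSpace (S K)]
    (b : ∀ K, Measure (S K))
    (T : ∀ K, S K → (Fin K → ESp d) ≃ₗ[ℝ] (Fin K → ESp d))
    (M : ℕ) (β : ℕ → ℝ) (N s k : ℕ)
    (g : (Fin (s + k) → ESp d) → ℝ) : (Fin s → ESp d) → ℝ :=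
  fun V =>
    if s + k ≤ N then
      ∑ n ∈ Finset.Icc 1 (M - k),
        β (k + n) * ((N : ℝ) / (N.choose (k + n) : ℝ)) * ((N - s).choose k : ℝ) *
          ∑ i : Fin n → Fin s,
            (if StrictMono i then collOp b T s n k (k + n) (by omega) i g V else 0)
    else 0

/-- The Boltzmann-hierarchy operator
`(C^∞_{s,s+k} g)(V_s) = β_{k+1}(k+1) Σ_{i=1}^s ∫ (g(V^{*i}_{s+k}) − g(V_{s+k})) db dv`. -/
def boltzC {d : ℕ} {S : ℕ → Type*} [∀ K, MeasurableSpace (S K)]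
    (b : ∀ K, Measure (S K))
    (T : ∀ K, S K → (Fin K → ESp d) ≃ₗ[ℝ] (Fin K → ESp d))
    (β : ℕ → ℝ) (s k : ℕ)
    (g : (Fin (s + k) → ESp d) → ℝ) : (Fin s → ESp d) → ℝ :=
  fun V => β (k + 1) * ((k : ℝ) + 1) *
    ∑ i : Fin s, collOp b T s 1 k (k + 1) (by omega) (fun _ => i) g V

/-- The generator `Ω` of the Master equation of the generalized Kac model. -/
def masterGen {d : ℕ} {S : ℕ → Type*} [∀ K, MeasurableSpace (S K)]
    (b : ∀ K, Measure (S K))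
    (T : ∀ K, S K → (Fin K → ESp d) ≃ₗ[ℝ] (Fin K → ESp d))
    (M : ℕ) (β : ℕ → ℝ) (N : ℕ)
    (f : (Fin N → ESp d) → ℝ) : (Fin N → ESp d) → ℝ :=
  fun V => (N : ℝ) * ∑ K ∈ Finset.Icc 1 M,
    β K * (1 / ((K.factorial : ℝ) * (N.choose K : ℝ))) *
      ∑ ι : Fin K → Fin N,
        (if Function.Injective ι then OmegaIdx b T K N ι f V else 0)

/-- The solution `e^{tΩ} f₀` of the Master equation, as a pointwise exponential series. -/
def masterSol {d : ℕ} {S : ℕ → Type*} [∀ K, MeasurableSpace (S K)]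
    (b : ∀ K, Measure (S K))
    (T : ∀ K, S K → (Fin K → ESp d) ≃ₗ[ℝ] (Fin K → ESp d))
    (M : ℕ) (β : ℕ → ℝ) (N : ℕ)
    (f₀ : (Fin N → ESp d) → ℝ) (t : ℝ) : (Fin N → ESp d) → ℝ :=
  fun V => ∑' n : ℕ, (t ^ n / (n.factorial : ℝ)) * (masterGen b T M β N)^[n] f₀ V

/-- `f` has `g` as derivative at time `t` in the `L¹(μ)` sense. -/
def HasL1DerivAt {α : Type*} [MeasurableSpace α] (μ : Measure α)
    (f : ℝ → α → ℝ) (g : α → ℝ) (t : ℝ) : Prop :=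
  Tendsto (fun h : ℝ => ∫ x, |(f (t + h) x - f t x) / h - g x| ∂μ)
    (nhdsWithin 0 {(0 : ℝ)}ᶜ) (nhds 0)

/-- A bounded measurable test function (an element of `L^∞`). -/
def BddMeas {α : Type*} [MeasurableSpace α] (φ : α → ℝ) : Prop :=
  Measurable φ ∧ ∃ C : ℝ, ∀ x, |φ x| ≤ C

end

section Helpers

variable {d : ℕ}

/-- Away from the slots in the range of `ι`, `extendMap` leaves the velocities untouched. -/
theorem extendMap_apply_of_notMem {K N : ℕ} (Tω : (Fin K → ESp d) → Fin K → ESp d)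
    {ι : Fin K → Fin N} (V : Fin N → ESp d) {j : Fin N} (hj : ¬ ∃ a, ι a = j) :
    extendMap Tω ι V j = V j := by
  simp only [extendMap, dif_neg hj]

theorem extendMap_apply_of_injective {K N : ℕ} (Tω : (Fin K → ESp d) → Fin K → ESp d)
    {ι : Fin K → Fin N} (hι : Function.Injective ι) (V : Fin N → ESp d) (a : Fin K) :
    extendMap Tω ι V (ι a) = Tω (fun a => V (ι a)) a := by
  have h : ∃ a', ι a' = ι a := ⟨a, rfl⟩
  simp only [extendMap, dif_pos h]
  rw [hι h.choose_spec]

theorem sum_norm_sq_extendMap {K N : ℕ} (Tω : (Fin K → ESp d) → Fin K → ESp d)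
    (hT : ∀ V, ∑ i, ‖Tω V i‖ ^ 2 = ∑ i, ‖V i‖ ^ 2)
    {ι : Fin K → Fin N} (hι : Function.Injective ι) (V : Fin N → ESp d) :
    ∑ j, ‖extendMap Tω ι V j‖ ^ 2 = ∑ j, ‖V j‖ ^ 2 := by
  rw [← Finset.sum_add_sum_compl (Finset.univ.image ι),
    ← Finset.sum_add_sum_compl (Finset.univ.image ι) (fun j => ‖V j‖ ^ 2)]
  congr 1
  · rw [Finset.sum_image hι.injOn, Finset.sum_image hι.injOn]
    simp only [extendMap_apply_of_injective Tω hι]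
    exact hT _
  · refine Finset.sum_congr rfl fun j hj => ?_
    rw [extendMap_apply_of_notMem]
    simpa using hj

/-- The extension of a linear collision map, as a linear map. -/
noncomputable def extendLinear {K N : ℕ} (Tω : (Fin K → ESp d) ≃ₗ[ℝ] (Fin K → ESp d))
    (ι : Fin K → Fin N) : (Fin N → ESp d) →ₗ[ℝ] (Fin N → ESp d) where
  toFun := extendMap Tω ι
  map_add' V W := by
    funext j
    by_cases h : ∃ a, ι a = j
    · have hadd : (fun a => (V + W) (ι a)) = (fun a => V (ι a)) + fun a => W (ι a) := rfl
      simp only [extendMap, dif_pos h, Pi.add_apply (extendMap _ _ _), hadd, map_add]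
      rfl
    · simp [extendMap, dif_neg h]
  map_smul' c V := by
    funext j
    by_cases h : ∃ a, ι a = j
    · have hsmul : (fun a => (c • V) (ι a)) = c • fun a => V (ι a) := rfl
      simp only [RingHom.id_apply, Pi.smul_apply c (extendMap _ _ _), extendMap, dif_pos h,
        hsmul, map_smul]
      rfl
    · simp [extendMap, dif_neg h]

/-- A linear map preserving the kinetic energy preserves the Lebesgue measure. -/
theorem map_volume_of_sum_norm_sq {N : ℕ} (f : (Fin N → ESp d) →ₗ[ℝ] (Fin N → ESp d))
    (hf : ∀ V, ∑ j, ‖f V j‖ ^ 2 = ∑ j, ‖V j‖ ^ 2) :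
    Measure.map f volume = volume := by
  let e := (WithLp.linearEquiv 2 ℝ (Fin N → ESp d)).symm
  let f' : PiLp 2 (fun _ : Fin N => ESp d) →ₗᵢ[ℝ] PiLp 2 (fun _ : Fin N => ESp d) :=
    { toLinearMap := (e : (Fin N → ESp d) →ₗ[ℝ] _) ∘ₗ f ∘ₗ (e.symm : _ →ₗ[ℝ] (Fin N → ESp d))
      norm_map' := fun x => by
        rw [← sq_eq_sq₀ (norm_nonneg _) (norm_nonneg _), PiLp.norm_sq_eq_of_L2,
          PiLp.norm_sq_eq_of_L2]
        exact hf _ }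
  have hdet : |LinearMap.det f| = 1 := by
    rw [← LinearMap.det_conj f e, ← Real.norm_eq_abs, ← LinearMap.normDet_eq_norm_det]
    exact f'.normDet_eq_one
  have hne : LinearMap.det f ≠ 0 := fun h => by simp [h] at hdet
  rw [Measure.map_linearMap_addHaar_eq_smul_addHaar _ hne, abs_inv, hdet]
  simp

theorem collIdx_injective {s n r K : ℕ} (hK : K = n + r) {i : Fin n → Fin s}
    (hi : Function.Injective i) : Function.Injective (collIdx s n r K hK i) := by
  intro a a' h
  have h' := congrArg Fin.val h
  by_cases ha : (a : ℕ) < n <;> by_cases ha' : (a' : ℕ) < n <;>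
    simp only [collIdx, ha, ha', dif_pos, dif_neg, not_false_eq_true, Fin.val_castLE] at h'
  · exact Fin.ext (Fin.mk.inj_iff.1 (hi (Fin.ext h')))
  · have := (i ⟨a, ha⟩).isLt
    omega
  · have := (i ⟨a', ha'⟩).isLt
    omega
  · exact Fin.ext (by omega)

theorem measurePreserving_finAppend (s r : ℕ) :
    MeasurePreserving (fun p : (Fin s → ESp d) × (Fin r → ESp d) => Fin.append p.1 p.2) := by
  have hsum := volume_measurePreserving_sumPiEquivProdPi_symm (fun _ : Fin s ⊕ Fin r => ESp d)
  have hcongr := volume_preserving_arrowCongr' (finSumFinEquiv (m := s) (n := r))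
    (MeasurableEquiv.refl (ESp d)) (MeasurePreserving.id _)
  refine (congrArg (fun F => MeasurePreserving F volume volume) ?_).mp (hcongr.comp hsum)
  funext p j
  refine Fin.addCases (fun a => ?_) (fun a => ?_) j <;>
    simp [MeasurableEquiv.arrowCongr', MeasurableEquiv.sumPiEquivProdPi, Equiv.sumPiEquivProdPi,
      Equiv.arrowCongr']

/-- Splitting off the first `s` velocities and the collision parameter. -/
theorem measurePreserving_param_append {S : Type*} [MeasurableSpace S] (b : Measure S)
    [IsProbabilityMeasure b] (s r : ℕ) :
    MeasurePreserving
      (fun q : (Fin s → ESp d) × (S × (Fin r → ESp d)) => (q.2.1, Fin.append q.1 q.2.2))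
      (volume.prod (b.prod volume)) (b.prod volume) := by
  have hassoc := (measurePreserving_prodAssoc (volume : Measure (Fin s → ESp d)) b
    (volume : Measure (Fin r → ESp d))).symm
  have hswap := (Measure.measurePreserving_swap (μ := (volume : Measure (Fin s → ESp d)))
    (ν := b)).prod (MeasurePreserving.id (volume : Measure (Fin r → ESp d)))
  have hassoc' := measurePreserving_prodAssoc b (volume : Measure (Fin s → ESp d))
    (volume : Measure (Fin r → ESp d))
  have happ := (MeasurePreserving.id b).prod (measurePreserving_finAppend (d := d) s r)
  exact happ.comp (hassoc'.comp (hswap.comp hassoc))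

theorem measurable_extendMap {S : Type*} [MeasurableSpace S] {K N : ℕ}
    {T : S → (Fin K → ESp d) ≃ₗ[ℝ] (Fin K → ESp d)}
    (hT : Measurable fun p : S × (Fin K → ESp d) => T p.1 p.2) (ι : Fin K → Fin N) :
    Measurable fun p : S × (Fin N → ESp d) => extendMap (T p.1) ι p.2 := by
  refine measurable_pi_iff.2 fun j => ?_
  by_cases h : ∃ a, ι a = j
  · simp only [extendMap, dif_pos h]
    have hsel : Measurable fun p : S × (Fin N → ESp d) =>
        (p.1, fun a => p.2 (ι a)) := by fun_prop
    exact (measurable_pi_apply _).comp (hT.comp hsel)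
  · simp only [extendMap, dif_neg h]
    fun_prop

theorem measurePreserving_extendMap {S : Type*} [MeasurableSpace S] (b : Measure S)
    [IsProbabilityMeasure b] {K N : ℕ} {T : S → (Fin K → ESp d) ≃ₗ[ℝ] (Fin K → ESp d)}
    (hT : Measurable fun p : S × (Fin K → ESp d) => T p.1 p.2)
    (hE : ∀ ω V, ∑ i, ‖T ω V i‖ ^ 2 = ∑ i, ‖V i‖ ^ 2)
    {ι : Fin K → Fin N} (hι : Function.Injective ι) :
    MeasurePreserving (fun p : S × (Fin N → ESp d) => (p.1, extendMap (T p.1) ι p.2))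
      (b.prod volume) (b.prod volume) :=
  (MeasurePreserving.id b).skew_product (measurable_extendMap hT ι) <| ae_of_all _ fun ω =>
    map_volume_of_sum_norm_sq (extendLinear (T ω) ι) (sum_norm_sq_extendMap _ (hE ω) hι)

/-- Each collision operator is bounded on `L¹` with norm at most `2`. -/
theorem integrable_collOp_and_integral_le {S : ℕ → Type*} [∀ K, MeasurableSpace (S K)]
    (b : ∀ K, Measure (S K)) [∀ K, IsProbabilityMeasure (b K)]
    (T : ∀ K, S K → (Fin K → ESp d) ≃ₗ[ℝ] (Fin K → ESp d)) (hmeas : KacMeas d S T)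
    {s n r K : ℕ} (hK : K = n + r)
    (hE : ∀ ω V, ∑ i, ‖T K ω V i‖ ^ 2 = ∑ i, ‖V i‖ ^ 2)
    {i : Fin n → Fin s} (hi : Function.Injective i)
    {g : (Fin (s + r) → ESp d) → ℝ} (hg : Integrable g) :
    Integrable (collOp b T s n r K hK i g) ∧
      ∫ V, |collOp b T s n r K hK i g V| ≤ 2 * ∫ W, |g W| := by
  have hΦ := measurePreserving_extendMap (b K) (hmeas K) hE (collIdx_injective hK hi)
  have hΨ := measurePreserving_param_append (d := d) (b K) s r
  have hsnd : Integrable (fun p : S K × (Fin (s + r) → ESp d) => g p.2) ((b K).prod volume) :=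
    hg.comp_snd (b K)
  have hsnd' : Integrable (fun q : (Fin s → ESp d) × (S K × (Fin r → ESp d)) =>
      g (Fin.append q.1 q.2.2)) (volume.prod ((b K).prod volume)) :=
    hΨ.integrable_comp_of_integrable hsnd
  have hcoll : Integrable (fun q : (Fin s → ESp d) × (S K × (Fin r → ESp d)) =>
      g (extendMap (T K q.2.1) (collIdx s n r K hK i) (Fin.append q.1 q.2.2)))
      (volume.prod ((b K).prod volume)) := (hΦ.comp hΨ).integrable_comp_of_integrable hsnd
  have hval : ∫ p : S K × (Fin (s + r) → ESp d), |g p.2| ∂((b K).prod volume) = ∫ W, |g W| := by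
    rw [integral_fun_snd (fun W => |g W|)]
    simp
  have hcomp : ∀ {Θ : (Fin s → ESp d) × (S K × (Fin r → ESp d)) → S K × (Fin (s + r) → ESp d)},
      MeasurePreserving Θ (volume.prod ((b K).prod volume)) ((b K).prod volume) →
      ∫ q, |g (Θ q).2| ∂(volume.prod ((b K).prod volume)) = ∫ W, |g W| := by
    intro Θ hΘ
    rw [← hval, ← hΘ.map_eq, integral_map hΘ.aemeasurable]
    rw [hΘ.map_eq]
    exact hsnd.abs.aestronglyMeasurable
  have hdiff := hcoll.sub hsnd'
  refine ⟨hdiff.integral_prod_left, ?_⟩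
  calc ∫ V, |collOp b T s n r K hK i g V|
      ≤ ∫ V, ∫ p, |g (extendMap (T K p.1) (collIdx s n r K hK i) (Fin.append V p.2)) -
          g (Fin.append V p.2)| ∂((b K).prod volume) :=
        integral_mono hdiff.integral_prod_left.abs hdiff.abs.integral_prod_left
          fun V => abs_integral_le_integral_abs
    _ = ∫ q : (Fin s → ESp d) × (S K × (Fin r → ESp d)),
          |g (extendMap (T K q.2.1) (collIdx s n r K hK i) (Fin.append q.1 q.2.2)) -
            g (Fin.append q.1 q.2.2)| ∂(volume.prod ((b K).prod volume)) :=
        (integral_prod _ hdiff.abs).symm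
    _ ≤ ∫ q : (Fin s → ESp d) × (S K × (Fin r → ESp d)),
          (|g (extendMap (T K q.2.1) (collIdx s n r K hK i) (Fin.append q.1 q.2.2))| +
            |g (Fin.append q.1 q.2.2)|) ∂(volume.prod ((b K).prod volume)) :=
        integral_mono hdiff.abs (hcoll.abs.add hsnd'.abs) fun q => abs_sub _ _
    _ = 2 * ∫ W, |g W| := by
        rw [integral_add hcoll.abs hsnd'.abs, two_mul]
        exact congrArg₂ (· + ·) (hcomp (hΦ.comp hΨ)) (hcomp hΨ)

theorem card_strictMono_le_choose (n s : ℕ) :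
    (Finset.univ.filter fun i : Fin n → Fin s => StrictMono i).card ≤ s.choose n := by
  have hcard : ((Finset.univ : Finset (Fin s)).powersetCard n).card = s.choose n := by simp
  rw [← hcard]
  refine Finset.card_le_card_of_injOn (fun i => Finset.univ.image i) (fun i hi => ?_) ?_
  · have hi' : StrictMono i := by simpa using hi
    simp [Finset.mem_powersetCard, Finset.card_image_of_injective _ hi'.injective]
  · intro i hi j hj hij
    have hi' : StrictMono i := by simpa using hi
    have hj' : StrictMono j := by simpa using hj
    rw [← hi'.range_inj hj']
    simpa using congrArg (fun t : Finset (Fin s) => (t : Set (Fin s))) hij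

/-- The combinatorial factor of the BBGKY operator is bounded uniformly in `N`. -/
theorem choose_factor_le {M N s k n : ℕ} {ε : ℝ} (hε1 : ε < 1) (hN : 0 < N)
    (hMN : (M : ℝ) ≤ ε * N) (hs : s ≤ N) (hn : 1 ≤ n) (hkn : k + n ≤ M) :
    (N : ℝ) / (N.choose (k + n) : ℝ) * ((N - s).choose k : ℝ) * (s.choose n : ℝ) ≤
      ((1 - ε) ^ (k + n))⁻¹ * ((k + n).choose k : ℝ) * s := by
  have hN' : (0 : ℝ) < N := by exact_mod_cast hN
  have hε : 0 < 1 - ε := by linarith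
  have hlow : ((1 - ε) * N) ^ (k + n) / ((k + n).factorial : ℝ) ≤ N.choose (k + n) := by
    refine le_trans ?_ (Nat.pow_le_choose (k + n) N)
    gcongr
    have hsub : N ≤ (N + 1 - (k + n)) + (k + n) := by omega
    have hsub' : (N : ℝ) ≤ ((N + 1 - (k + n) : ℕ) : ℝ) + ((k + n : ℕ) : ℝ) := by
      exact_mod_cast hsub
    have hkn' : ((k + n : ℕ) : ℝ) ≤ M := by exact_mod_cast hkn
    linarith
  have hup : ((N - s).choose k : ℝ) ≤ (N : ℝ) ^ k / (k.factorial : ℝ) := by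
    refine (Nat.choose_le_pow_div k (N - s)).trans ?_
    gcongr
    omega
  have hup' : (s.choose n : ℝ) ≤ s * (N : ℝ) ^ (n - 1) / (n.factorial : ℝ) := by
    refine (Nat.choose_le_pow_div n s).trans ?_
    rw [← mul_pow_sub_one (by omega : n ≠ 0)]
    gcongr
  have hfact : ((k + n).choose k : ℝ) =
      ((k + n).factorial : ℝ) / ((k.factorial : ℝ) * (n.factorial : ℝ)) := by
    rw [Nat.cast_choose ℝ (Nat.le_add_right k n), Nat.add_sub_cancel_left]
  calc (N : ℝ) / (N.choose (k + n) : ℝ) * ((N - s).choose k : ℝ) * (s.choose n : ℝ)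
      ≤ N / (((1 - ε) * N) ^ (k + n) / ((k + n).factorial : ℝ)) *
          ((N : ℝ) ^ k / (k.factorial : ℝ)) * (s * (N : ℝ) ^ (n - 1) / (n.factorial : ℝ)) := by
        gcongr
    _ = ((1 - ε) ^ (k + n))⁻¹ * ((k + n).choose k : ℝ) * s := by
        obtain ⟨m, rfl⟩ : ∃ m, n = m + 1 := ⟨n - 1, by omega⟩
        rw [hfact, Nat.add_sub_cancel, mul_pow]
        field_simp
        ring

/-- The `L¹` norm of the sum of all collision operators of a given order. -/
theorem integrable_sum_collOp_and_integral_le {S : ℕ → Type*} [∀ K, MeasurableSpace (S K)]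
    (b : ∀ K, Measure (S K)) [∀ K, IsProbabilityMeasure (b K)]
    (T : ∀ K, S K → (Fin K → ESp d) ≃ₗ[ℝ] (Fin K → ESp d)) (hmeas : KacMeas d S T)
    {s n r K : ℕ} (hK : K = n + r)
    (hE : ∀ ω V, ∑ i, ‖T K ω V i‖ ^ 2 = ∑ i, ‖V i‖ ^ 2)
    {g : (Fin (s + r) → ESp d) → ℝ} (hg : Integrable g) :
    Integrable (fun V => ∑ i : Fin n → Fin s,
        (if StrictMono i then collOp b T s n r K hK i g V else 0)) ∧
      ∫ V, |∑ i : Fin n → Fin s, (if StrictMono i then collOp b T s n r K hK i g V else 0)| ≤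
        (s.choose n : ℝ) * (2 * ∫ W, |g W|) := by
  simp only [← Finset.sum_filter]
  have hcoll : ∀ i ∈ Finset.univ.filter fun i : Fin n → Fin s => StrictMono i,
      Integrable (collOp b T s n r K hK i g) ∧
        ∫ V, |collOp b T s n r K hK i g V| ≤ 2 * ∫ W, |g W| := fun i hi =>
    integrable_collOp_and_integral_le b T hmeas hK hE (Finset.mem_filter.1 hi).2.injective hg
  have hsum := integrable_finsetSum _ fun i hi => (hcoll i hi).1
  refine ⟨hsum, ?_⟩
  have hnonneg : 0 ≤ 2 * ∫ W, |g W| := by positivity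
  calc ∫ V, |∑ i ∈ Finset.univ.filter fun i : Fin n → Fin s => StrictMono i,
          collOp b T s n r K hK i g V|
      ≤ ∫ V, ∑ i ∈ Finset.univ.filter fun i : Fin n → Fin s => StrictMono i,
          |collOp b T s n r K hK i g V| :=
        integral_mono hsum.abs (integrable_finsetSum _ fun i hi => (hcoll i hi).1.abs)
          fun V => Finset.abs_sum_le_sum_abs _ _
    _ = ∑ i ∈ Finset.univ.filter fun i : Fin n → Fin s => StrictMono i,
          ∫ V, |collOp b T s n r K hK i g V| :=
        integral_finsetSum _ fun i hi => (hcoll i hi).1.abs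
    _ ≤ (Finset.univ.filter fun i : Fin n → Fin s => StrictMono i).card •
          (2 * ∫ W, |g W|) := Finset.sum_le_card_nsmul _ _ _ fun i hi => (hcoll i hi).2
    _ ≤ (s.choose n : ℝ) * (2 * ∫ W, |g W|) := by
        rw [nsmul_eq_mul]
        gcongr
        exact card_strictMono_le_choose n s

end Helpers

/-- **Uniform operator bound for the BBGKY operators** (Lemma 6.4 of the paper). If
`M/N ≤ ε ∈ (0,1)`, then for every `s`, every `0 ≤ k ≤ M−1` and every
`g ∈ L¹_sym(ℝ^{d(s+k)})`, `‖C^N_{s,s+k} g‖_{L¹} ≤ R_k·s·‖g‖_{L¹}` with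
`R_k = 2 Σ_{ℓ=k+1}^M β_ℓ (1−ε)^{−ℓ} binom(ℓ,k)`, independent of `s` and `N`. -/
theorem stmt8 (d M : ℕ) (S : ℕ → Type*) [∀ K, MeasurableSpace (S K)]
    (b : ∀ K, Measure (S K)) [∀ K, IsProbabilityMeasure (b K)]
    (T : ∀ K, S K → (Fin K → ESp d) ≃ₗ[ℝ] (Fin K → ESp d))
    (hmeas : KacMeas d S T)
    (h1 : KacH1 d M S T) (h2 : KacH2 d M S b T) (h3 : KacH3 d M S b T)
    (β : ℕ → ℝ) (hβ : ∀ K, 0 ≤ β K) (hβ1 : ∑ K ∈ Finset.Icc 1 M, β K = 1)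
    (N : ℕ) (ε : ℝ) (hε0 : 0 < ε) (hε1 : ε < 1) (hMN : (M : ℝ) / (N : ℝ) ≤ ε)
    (s k : ℕ) (hk : k ≤ M - 1)
    (g : (Fin (s + k) → ESp d) → ℝ) (hg : Integrable g) (hgsym : SymFun g) :
    ∫ V, |bbgkyC b T M β N s k g V| ≤
      (2 * ∑ ℓ ∈ Finset.Icc (k + 1) M, β ℓ * ((1 - ε) ^ ℓ)⁻¹ * (ℓ.choose k : ℝ)) * (s : ℝ) *
        ∫ W, |g W| := by
  have hεpos : 0 < 1 - ε := by linarith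
  have hg0 : 0 ≤ ∫ W, |g W| := by positivity
  have hR : 0 ≤ (2 * ∑ ℓ ∈ Finset.Icc (k + 1) M,
      β ℓ * ((1 - ε) ^ ℓ)⁻¹ * (ℓ.choose k : ℝ)) * (s : ℝ) * ∫ W, |g W| := by
    have := Finset.sum_nonneg fun ℓ (_ : ℓ ∈ Finset.Icc (k + 1) M) =>
      mul_nonneg (mul_nonneg (hβ ℓ) (by positivity : 0 ≤ ((1 - ε) ^ ℓ)⁻¹))
        (Nat.cast_nonneg' (ℓ.choose k))
    positivity
  by_cases hsk : s + k ≤ N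
  swap
  · simpa [bbgkyC, hsk] using hR
  rcases Nat.eq_zero_or_pos s with rfl | hs
  · refine le_of_eq_of_le ?_ hR
    have hzero : ∀ V, bbgkyC b T M β N 0 k g V = 0 := fun V => by
      simp only [bbgkyC, if_pos hsk]
      refine Finset.sum_eq_zero fun n hn => ?_
      have : Nonempty (Fin n) := ⟨⟨0, (Finset.mem_Icc.1 hn).1⟩⟩
      simp
    simp [hzero]
  have hN : 0 < N := by omega
  have hMN' : (M : ℝ) ≤ ε * N := (div_le_iff₀ (by exact_mod_cast hN)).1 hMN
  have hsum := fun n (hn : n ∈ Finset.Icc 1 (M - k)) =>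
    integrable_sum_collOp_and_integral_le b T hmeas (s := s) (by omega : k + n = n + k)
      (h1 (k + n) (by have := Finset.mem_Icc.1 hn; omega)
        (by have := Finset.mem_Icc.1 hn; omega)) hg
  have hcoef : ∀ n, 0 ≤ β (k + n) * ((N : ℝ) / (N.choose (k + n) : ℝ)) *
      ((N - s).choose k : ℝ) := fun n => by
    have := hβ (k + n)
    positivity
  have hreindex : ∑ ℓ ∈ Finset.Icc (k + 1) M, β ℓ * ((1 - ε) ^ ℓ)⁻¹ * (ℓ.choose k : ℝ) =
      ∑ n ∈ Finset.Icc 1 (M - k),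
        β (k + n) * ((1 - ε) ^ (k + n))⁻¹ * ((k + n).choose k : ℝ) := by
    refine Finset.sum_nbij' (fun ℓ => ℓ - k) (fun n => k + n) ?_ ?_ ?_ ?_ ?_
    · intro ℓ hℓ
      simp only [Finset.mem_Icc] at hℓ ⊢
      omega
    · intro n hn
      simp only [Finset.mem_Icc] at hn ⊢
      omega
    · intro ℓ hℓ
      simp only [Finset.mem_Icc] at hℓ
      omega
    · intro n _
      omega
    · intro ℓ hℓ
      simp only [Finset.mem_Icc] at hℓ
      rw [Nat.add_sub_cancel' (by omega : k ≤ ℓ)]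
  simp only [bbgkyC, if_pos hsk]
  calc _ ≤ ∫ V, ∑ n ∈ Finset.Icc 1 (M - k),
          β (k + n) * ((N : ℝ) / (N.choose (k + n) : ℝ)) * ((N - s).choose k : ℝ) *
            |∑ i : Fin n → Fin s,
              (if StrictMono i then collOp b T s n k (k + n) (by omega) i g V else 0)| := by
        refine integral_mono
          (integrable_finsetSum _ fun n hn => (hsum n hn).1.const_mul _).abs
          (integrable_finsetSum _ fun n hn => (hsum n hn).1.abs.const_mul _) fun V => ?_
        refine (Finset.abs_sum_le_sum_abs _ _).trans_eq (Finset.sum_congr rfl fun n _ => ?_)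
        rw [abs_mul, abs_of_nonneg (hcoef n)]
    _ = ∑ n ∈ Finset.Icc 1 (M - k),
          β (k + n) * ((N : ℝ) / (N.choose (k + n) : ℝ)) * ((N - s).choose k : ℝ) *
            ∫ V, |∑ i : Fin n → Fin s,
              (if StrictMono i then collOp b T s n k (k + n) (by omega) i g V else 0)| := by
        rw [integral_finsetSum _ fun n hn => (hsum n hn).1.abs.const_mul _]
        simp only [integral_const_mul]
    _ ≤ ∑ n ∈ Finset.Icc 1 (M - k),
          β (k + n) * ((1 - ε) ^ (k + n))⁻¹ * ((k + n).choose k : ℝ) *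
            (2 * s * ∫ W, |g W|) := by
        refine Finset.sum_le_sum fun n hn => ?_
        refine (mul_le_mul_of_nonneg_left (hsum n hn).2 (hcoef n)).trans ?_
        have hn' := Finset.mem_Icc.1 hn
        have hfactor := mul_le_mul_of_nonneg_left
          (choose_factor_le (s := s) (k := k) (n := n) hε1 hN hMN' (by omega) hn'.1 (by omega))
          (mul_nonneg (hβ (k + n)) (mul_nonneg zero_le_two hg0))
        linarith
    _ = _ := by
        rw [← Finset.sum_mul, hreindex]
        ring
end

section
/- Continuity estimates for the collision operators: For every K = 1,…,M and every f, g ∈ L^1(ℝ^d), the collision operator satisfies ‖Q_K(f,…,f)‖_{L^1} ≤ 2K‖f‖_{L^1}^K and ‖Q_K(f,…,f) − Q_K(g,…,g)‖_{L^1} ≤ 2K²(‖f‖_{L^1}^{K−1} + ‖g‖_{L^1}^{K−1})‖f − g‖_{L^1}. -/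
open MeasureTheory Filter Finset
open scoped Classical

noncomputable section

/-- The full collision vector `V = (v_1, …, v_K)` built from `v₁ = v` and `(v_2,…,v_K) = w`. -/
def fullV {d K : ℕ} (v : ESp d) (w : Fin (K - 1) → ESp d) : Fin K → ESp d :=
  fun i => if h : (i : ℕ) = 0 then v else w ⟨(i : ℕ) - 1, by have := i.isLt; omega⟩

/-- The `K`-th order collision operator
`Q_K(f,…,f)(v₁) = K ∫_{S_K×ℝ^{d(K−1)}} ((⊗f)(T_K^ω V) − (⊗f)(V)) db_K(ω) dv_2⋯dv_K`. -/
def QK {d : ℕ} {S : ℕ → Type*} [∀ K, MeasurableSpace (S K)]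
    (b : ∀ K, Measure (S K))
    (T : ∀ K, S K → (Fin K → ESp d) ≃ₗ[ℝ] (Fin K → ESp d))
    (K : ℕ) (f : ESp d → ℝ) : ESp d → ℝ :=
  fun v => (K : ℝ) * ∫ p : S K × (Fin (K - 1) → ESp d),
    ((∏ i : Fin K, f (T K p.1 (fullV v p.2) i)) - ∏ i : Fin K, f (fullV v p.2 i))
      ∂((b K).prod volume)

/-- `f : [0,T] → L¹` is continuous in the `L¹(μ)` sense on `A`. -/
def ContL1On {α : Type*} [MeasurableSpace α] (μ : Measure α)
    (f : ℝ → α → ℝ) (A : Set ℝ) : Prop :=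
  ∀ t₀ ∈ A, Tendsto (fun t => ∫ x, |f t x - f t₀ x| ∂μ) (nhdsWithin t₀ A) (nhds 0)

end

/-- A linear automorphism of `ℝ^{dK}` conserving the kinetic energy preserves Lebesgue measure. -/
theorem measurePreserving_of_sum_norm_sq_eq {d K : ℕ}
    (A : (Fin K → ESp d) ≃ₗ[ℝ] (Fin K → ESp d))
    (hA : ∀ V, ∑ i, ‖A V i‖ ^ 2 = ∑ i, ‖V i‖ ^ 2) :
    MeasurePreserving A volume volume := by
  have hcont : Continuous A := A.toLinearMap.continuous_of_finiteDimensional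
  refine ⟨hcont.measurable, ?_⟩
  have hmap := Measure.map_linearMap_addHaar_eq_smul_addHaar
    (volume : Measure (Fin K → ESp d)) A.isUnit_det'.ne_zero
  rw [LinearEquiv.coe_coe] at hmap
  set B : Set (Fin K → ESp d) := {V | ∑ i, ‖V i‖ ^ 2 < 1} with hB
  have hopen : IsOpen B := isOpen_lt (by fun_prop) continuous_const
  have hpos : volume B ≠ 0 := (hopen.measure_pos volume ⟨0, by simp [hB]⟩).ne'
  have hfin : volume B ≠ ⊤ := by
    have hball : volume (Metric.closedBall (0 : Fin K → ESp d) 1) ≠ ⊤ :=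
      measure_closedBall_lt_top.ne
    refine measure_ne_top_of_subset (fun V hV => ?_) hball
    rw [mem_closedBall_zero_iff, pi_norm_le_iff_of_nonneg zero_le_one]
    intro i
    have hi : ‖V i‖ ^ 2 ≤ ∑ j, ‖V j‖ ^ 2 :=
      Finset.single_le_sum (f := fun j => ‖V j‖ ^ 2) (fun j _ => sq_nonneg _) (Finset.mem_univ i)
    have hV' : ∑ j, ‖V j‖ ^ 2 < 1 := hV
    nlinarith [norm_nonneg (V i)]
  have hpre : A ⁻¹' B = B := by
    ext V
    simp only [hB, Set.mem_preimage, Set.mem_ofPred_eq, hA]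
  have hone := congrArg (fun μ : Measure (Fin K → ESp d) => μ B) hmap
  simp only [Measure.map_apply hcont.measurable hopen.measurableSet, hpre, Measure.smul_apply,
    smul_eq_mul] at hone
  rw [hmap, (ENNReal.mul_eq_right hpos hfin).1 hone.symm, one_smul]

/-- Prepending the first velocity preserves Lebesgue measure. -/
theorem measurePreserving_fullV (d n : ℕ) :
    MeasurePreserving (fun q : ESp d × (Fin n → ESp d) => (fullV q.1 q.2 : Fin (n + 1) → ESp d))
      (volume.prod volume) volume := by
  suffices h : (fun q : ESp d × (Fin n → ESp d) => (fullV q.1 q.2 : Fin (n + 1) → ESp d)) =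
      (MeasurableEquiv.piFinSuccAbove (fun _ : Fin (n + 1) => ESp d) 0).symm by
    rw [h]
    exact (volume_preserving_piFinSuccAbove (fun _ : Fin (n + 1) => ESp d) 0).symm
  funext q i
  refine Fin.cases ?_ (fun j => ?_) i
  · simp [fullV, MeasurableEquiv.piFinSuccAbove]
  · simp [fullV, MeasurableEquiv.piFinSuccAbove]

section PartialIntegral

variable {X Y Z : Type*} [MeasurableSpace X] [MeasurableSpace Y] [MeasurableSpace Z]
  {μ : Measure X} {ν : Measure Y} {ρ : Measure Z} [SFinite μ] [SFinite ν] {φ ψ : X × Y → Z}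

/-- The partial integral of the gain-minus-loss difference of an integrable function along two
measure preserving maps has `L¹` norm at most twice that of the function. -/
theorem integral_abs_integral_comp_sub_comp_le
    (hφ : MeasurePreserving φ (μ.prod ν) ρ) (hψ : MeasurePreserving ψ (μ.prod ν) ρ)
    {H : Z → ℝ} (hH : Integrable H ρ) :
    ∫ x, |∫ y, (H (φ (x, y)) - H (ψ (x, y))) ∂ν| ∂μ ≤ 2 * ∫ z, |H z| ∂ρ := by
  have hcomp : ∀ {χ : X × Y → Z}, MeasurePreserving χ (μ.prod ν) ρ →
      ∫ q, |H (χ q)| ∂(μ.prod ν) = ∫ z, |H z| ∂ρ := fun {χ} hχ => by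
    rw [← hχ.map_eq, integral_map hχ.measurable.aemeasurable]
    rw [hχ.map_eq]
    exact hH.abs.aestronglyMeasurable
  have h₁ := hφ.integrable_comp_of_integrable hH
  have h₂ := hψ.integrable_comp_of_integrable hH
  have h := h₁.sub h₂
  calc ∫ x, |∫ y, (H (φ (x, y)) - H (ψ (x, y))) ∂ν| ∂μ
      ≤ ∫ x, ∫ y, |H (φ (x, y)) - H (ψ (x, y))| ∂ν ∂μ :=
        integral_mono h.integral_prod_left.abs h.abs.integral_prod_left
          fun x => abs_integral_le_integral_abs
    _ = ∫ q, |H (φ q) - H (ψ q)| ∂(μ.prod ν) := (integral_prod _ h.abs).symm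
    _ ≤ ∫ q, (|H (φ q)| + |H (ψ q)|) ∂(μ.prod ν) :=
        integral_mono h.abs (h₁.abs.add h₂.abs) fun q => abs_sub _ _
    _ = 2 * ∫ z, |H z| ∂ρ := by
        refine (integral_add h₁.abs h₂.abs).trans ?_
        simp only [Function.comp_apply]
        rw [hcomp hφ, hcomp hψ, two_mul]

/-- Partial integrals of gain-minus-loss differences commute with subtraction almost everywhere. -/
theorem ae_integral_comp_sub_comp_sub
    (hφ : MeasurePreserving φ (μ.prod ν) ρ) (hψ : MeasurePreserving ψ (μ.prod ν) ρ)
    {F G : Z → ℝ} (hF : Integrable F ρ) (hG : Integrable G ρ) :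
    ∀ᵐ x ∂μ, (∫ y, (F (φ (x, y)) - F (ψ (x, y))) ∂ν) - ∫ y, (G (φ (x, y)) - G (ψ (x, y))) ∂ν =
      ∫ y, ((F - G) (φ (x, y)) - (F - G) (ψ (x, y))) ∂ν := by
  have hF' := (hφ.integrable_comp_of_integrable hF).sub (hψ.integrable_comp_of_integrable hF)
  have hG' := (hφ.integrable_comp_of_integrable hG).sub (hψ.integrable_comp_of_integrable hG)
  filter_upwards [hF'.prod_right_ae, hG'.prod_right_ae] with x hx hx'
  refine (integral_sub hx hx').symm.trans (integral_congr_ae (ae_of_all _ fun y => ?_))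
  simp only [Pi.sub_apply, Function.comp_apply]
  ring

end PartialIntegral

/-- Tensor powers are locally Lipschitz in `L¹`. -/
theorem integral_abs_prod_sub_prod_le {d : ℕ} {f g : ESp d → ℝ} (hf : Integrable f)
    (hg : Integrable g) {m : ℝ} (hfm : ∫ v, |f v| ≤ m) (hgm : ∫ v, |g v| ≤ m) (n : ℕ) :
    ∫ V : Fin n → ESp d, |(∏ i, f (V i)) - ∏ i, g (V i)| ≤
      n * m ^ (n - 1) * ∫ v, |f v - g v| := by
  have hm : 0 ≤ m := (integral_nonneg fun v => abs_nonneg (f v)).trans hfm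
  have hδ : 0 ≤ ∫ v, |f v - g v| := integral_nonneg fun v => abs_nonneg _
  induction n with
  | zero => simp
  | succ n ih =>
    have hF : Integrable fun V : Fin n → ESp d => ∏ i, f (V i) :=
      Integrable.fintype_prod (f := fun _ => f) fun _ => hf
    have hG : Integrable fun V : Fin n → ESp d => ∏ i, g (V i) :=
      Integrable.fintype_prod (f := fun _ => g) fun _ => hg
    have h₁ := hf.mul_prod (hF.sub hG)
    have h₂ := (hf.sub hg).mul_prod hG
    have hGn : ∫ V : Fin n → ESp d, |∏ i, g (V i)| ≤ m ^ n := by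
      simp_rw [Finset.abs_prod]
      rw [integral_fintype_prod_volume_eq_pow (fun v => |g v|), Fintype.card_fin]
      exact pow_le_pow_left₀ (integral_nonneg fun v => abs_nonneg _) hgm n
    have hsplit : ∫ V : Fin (n + 1) → ESp d, |(∏ i, f (V i)) - ∏ i, g (V i)| =
        ∫ q : ESp d × (Fin n → ESp d),
          |f q.1 * ((∏ i, f (q.2 i)) - ∏ i, g (q.2 i)) + (f q.1 - g q.1) * ∏ i, g (q.2 i)|
            ∂(volume.prod volume) := by
      refine Eq.trans (integral_congr_ae (ae_of_all _ fun V => ?_))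
        ((volume_preserving_piFinSuccAbove (fun _ : Fin (n + 1) => ESp d) 0).integral_comp' _)
      simp only [Fin.prod_univ_succ, MeasurableEquiv.piFinSuccAbove, Fin.insertNthEquiv,
        MeasurableEquiv.coe_mk, Equiv.coe_fn_symm_mk, Fin.removeNth, Fin.succAbove_zero]
      congr 1
      ring
    rw [hsplit]
    calc _ ≤ ∫ q : ESp d × (Fin n → ESp d),
          (|f q.1| * |(∏ i, f (q.2 i)) - ∏ i, g (q.2 i)| +
            |f q.1 - g q.1| * |∏ i, g (q.2 i)|) ∂(volume.prod volume) := by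
          refine integral_mono (h₁.add h₂).abs
            ((hf.abs.mul_prod (hF.sub hG).abs).add ((hf.sub hg).abs.mul_prod hG.abs)) fun q => ?_
          exact (abs_add_le _ _).trans_eq (congrArg₂ _ (abs_mul _ _) (abs_mul _ _))
      _ = (∫ v, |f v|) * (∫ V : Fin n → ESp d, |(∏ i, f (V i)) - ∏ i, g (V i)|) +
            (∫ v, |f v - g v|) * ∫ V : Fin n → ESp d, |∏ i, g (V i)| := by
          refine (integral_add (hf.abs.mul_prod (hF.sub hG).abs)
            ((hf.sub hg).abs.mul_prod hG.abs)).trans ?_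
          exact congrArg₂ _ (integral_prod_mul (fun v => |f v|)
            fun V : Fin n → ESp d => |(∏ i, f (V i)) - ∏ i, g (V i)|)
            (integral_prod_mul (fun v => |f v - g v|) fun V : Fin n → ESp d => |∏ i, g (V i)|)
      _ ≤ m * (n * m ^ (n - 1) * ∫ v, |f v - g v|) + (∫ v, |f v - g v|) * m ^ n := by
          gcongr
      _ = _ := by
          rcases n with _ | n
          · simp
          · simp only [Nat.add_sub_cancel]
            push_cast
            ring

/-- **Continuity estimates for the collision operators** (estimates (7.5)–(7.6) of the paper).
For every `K = 1,…,M` and `f, g ∈ L¹(ℝ^d)`: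
`‖Q_K(f,…,f)‖_{L¹} ≤ 2K ‖f‖_{L¹}^K` and
`‖Q_K(f,…,f) − Q_K(g,…,g)‖_{L¹} ≤ 2K² (‖f‖_{L¹}^{K−1} + ‖g‖_{L¹}^{K−1}) ‖f−g‖_{L¹}`. -/
theorem stmt16 (d M : ℕ) (S : ℕ → Type*) [∀ K, MeasurableSpace (S K)]
    (b : ∀ K, Measure (S K)) [∀ K, IsProbabilityMeasure (b K)]
    (T : ∀ K, S K → (Fin K → ESp d) ≃ₗ[ℝ] (Fin K → ESp d))
    (hmeas : KacMeas d S T)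
    (h1 : KacH1 d M S T) (h2 : KacH2 d M S b T) (h3 : KacH3 d M S b T)
    (K : ℕ) (hK1 : 1 ≤ K) (hKM : K ≤ M)
    (f g : ESp d → ℝ) (hf : Integrable f) (hg : Integrable g) :
    (∫ v, |QK b T K f v| ≤ 2 * (K : ℝ) * (∫ v, |f v|) ^ K) ∧
    (∫ v, |QK b T K f v - QK b T K g v| ≤
      2 * (K : ℝ) ^ 2 * ((∫ v, |f v|) ^ (K - 1) + (∫ v, |g v|) ^ (K - 1)) *
        ∫ v, |f v - g v|) := by
  obtain ⟨n, rfl⟩ : ∃ n, K = n + 1 := ⟨K - 1, by omega⟩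
  have hV : MeasurePreserving
      (fun q : ESp d × S (n + 1) × (Fin n → ESp d) =>
        (q.2.1, (fullV q.1 q.2.2 : Fin (n + 1) → ESp d)))
      (volume.prod ((b (n + 1)).prod volume)) ((b (n + 1)).prod volume) :=
    ((MeasurePreserving.id _).prod (measurePreserving_fullV d n)).comp <|
      (measurePreserving_prodAssoc _ _ _).comp <|
        (Measure.measurePreserving_swap.prod (MeasurePreserving.id _)).comp <|
          (measurePreserving_prodAssoc volume (b (n + 1)) volume).symm
  have hψ := measurePreserving_snd.comp hV
  have hφ := (measurePreserving_snd.comp <| (MeasurePreserving.id (b (n + 1))).skew_product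
    (g := fun ω V => T (n + 1) ω V) (hmeas (n + 1)) <| ae_of_all _ fun ω =>
      (measurePreserving_of_sum_norm_sq_eq (T (n + 1) ω) (h1 _ hK1 hKM ω)).map_eq).comp hV
  have hF : Integrable fun V : Fin (n + 1) → ESp d => ∏ i, f (V i) :=
    Integrable.fintype_prod (f := fun _ => f) fun _ => hf
  have hG : Integrable fun V : Fin (n + 1) → ESp d => ∏ i, g (V i) :=
    Integrable.fintype_prod (f := fun _ => g) fun _ => hg
  have hK : (0 : ℝ) ≤ (n + 1 : ℕ) := Nat.cast_nonneg _
  constructor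
  · have hQ := integral_abs_integral_comp_sub_comp_le hφ hψ hF
    simp_rw [Finset.abs_prod] at hQ
    rw [integral_fintype_prod_volume_eq_pow (fun v => |f v|), Fintype.card_fin] at hQ
    simp only [QK, abs_mul, Nat.abs_cast]
    rw [integral_const_mul, mul_right_comm, mul_comm]
    exact mul_le_mul_of_nonneg_right hQ hK
  · have hQ := integral_abs_integral_comp_sub_comp_le hφ hψ (hF.sub hG)
    have hA : 0 ≤ ∫ v, |f v| := integral_nonneg fun v => abs_nonneg _
    have hB : 0 ≤ ∫ v, |g v| := integral_nonneg fun v => abs_nonneg _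
    have hδ : 0 ≤ ∫ v, |f v - g v| := integral_nonneg fun v => abs_nonneg _
    have hmax : max (∫ v, |f v|) (∫ v, |g v|) ^ n ≤ (∫ v, |f v|) ^ n + (∫ v, |g v|) ^ n := by
      rcases max_choice (∫ v, |f v|) (∫ v, |g v|) with h | h <;> rw [h]
      · exact le_add_of_nonneg_right (pow_nonneg hB n)
      · exact le_add_of_nonneg_left (pow_nonneg hA n)
    have hdiff : ∫ V : Fin (n + 1) → ESp d, |(∏ i, f (V i)) - ∏ i, g (V i)| ≤
        (n + 1 : ℕ) * ((∫ v, |f v|) ^ n + (∫ v, |g v|) ^ n) * ∫ v, |f v - g v| :=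
      (integral_abs_prod_sub_prod_le hf hg (le_max_left _ _) (le_max_right _ _) (n + 1)).trans <|
        by rw [Nat.add_sub_cancel]; gcongr
    calc ∫ v, |QK b T (n + 1) f v - QK b T (n + 1) g v|
        = (n + 1 : ℕ) * _ := by
          rw [← integral_const_mul]
          refine integral_congr_ae ?_
          filter_upwards [ae_integral_comp_sub_comp_sub hφ hψ hF hG] with v hv
          rw [← abs_of_nonneg hK, ← abs_mul, ← hv, mul_sub]
          rfl
      _ ≤ (n + 1 : ℕ) * (2 * ((n + 1 : ℕ) * ((∫ v, |f v|) ^ n + (∫ v, |g v|) ^ n) *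
            ∫ v, |f v - g v|)) :=
          mul_le_mul_of_nonneg_left
            (hQ.trans (mul_le_mul_of_nonneg_left hdiff zero_le_two)) hK
      _ = _ := by
          rw [Nat.add_sub_cancel]
          ring
end
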